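/- arXiv:2605.13988 — 2 statements merged into one kernel-verified Lean document; each statement's English description precedes it below -/
import Mathlib

section
/- Fix z₀ > 0 and a constant μ > 0. For x ∈ ℝ² let R(x) = (x₁, x₂, z₀) ∈ ℝ³ and for a ∈ {1, 2, 3} define the dipolar Green-tensor channel G_a : ℝ² → ℝ by G_a(x) = (μ / (4π)) · (3 · R(x)_a · z₀ − ‖R(x)‖² · δ_{a3}) / ‖R(x)‖⁵, where δ_{a3} is 1 if a = 3 and 0 otherwise. Then each G_a is integrable on ℝ², and there exists a constant C ≥ 0 such that for all ξ ∈ ℝ², the Fourier transform with convention 𝓕G_a(ξ) = ∫_{ℝ²} e^{−2πi⟨x,ξ⟩} G_a(x) dx satisfies |𝓕G_a(ξ)| ≤ C · ‖ξ‖ · e^{−2π z₀ ‖ξ‖}. -/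
open MeasureTheory Real
open scoped FourierTransform

section

open Set

theorem integral_Ioi_comp_sub_div (α β : ℝ) (hα : 0 < α) (hβ : 0 < β) :
    IntegrableOn (fun u : ℝ => (α + β / u ^ 2) * exp (-(α * u - β / u) ^ 2)) (Ioi 0) ∧
    ∫ u in Ioi (0 : ℝ), (α + β / u ^ 2) * exp (-(α * u - β / u) ^ 2) = √π := by
  have hd : ∀ u ∈ Ioi (0 : ℝ),
      HasDerivWithinAt (fun u : ℝ => α * u - β / u) (α + β / u ^ 2) (Ioi 0) u := by
    intro u hu
    have hu' : u ≠ 0 := (mem_Ioi.1 hu).ne'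
    have h := ((hasDerivAt_id u).const_mul α).sub ((hasDerivAt_inv hu').const_mul β)
    refine (h.congr_deriv ?_).hasDerivWithinAt
    field_simp
    ring
  have hinj : InjOn (fun u : ℝ => α * u - β / u) (Ioi 0) := by
    intro u hu v hv h
    have hu' : 0 < u := hu
    have hv' : 0 < v := hv
    have h' : α * u - β / u = α * v - β / v := h
    have : (u - v) * (α + β / (u * v)) = 0 := by
      have e : (u - v) * (α + β / (u * v)) = (α * u - β / u) - (α * v - β / v) := by
        field_simp
        ring
      rw [e, h', sub_self]
    rcases mul_eq_zero.1 this with h | h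
    · linarith
    · have : 0 < α + β / (u * v) := by positivity
      linarith
  have himg : Set.image (fun u : ℝ => α * u - β / u) (Ioi 0) = univ := by
    refine eq_univ_of_forall fun v => ?_
    have hs : |v| < √(v ^ 2 + 4 * α * β) := by
      rw [← Real.sqrt_sq_eq_abs]
      exact Real.sqrt_lt_sqrt (sq_nonneg v) (by nlinarith [mul_pos hα hβ])
    have hq : √(v ^ 2 + 4 * α * β) ^ 2 = v ^ 2 + 4 * α * β := Real.sq_sqrt (by positivity)
    set q := √(v ^ 2 + 4 * α * β)
    have hp : 0 < v + q := by linarith [neg_abs_le v]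
    refine ⟨(v + q) / (2 * α), div_pos hp (by positivity), ?_⟩
    change α * ((v + q) / (2 * α)) - β / ((v + q) / (2 * α)) = v
    field_simp
    nlinarith
  have habs : ∀ u ∈ Ioi (0 : ℝ), |α + β / u ^ 2| • exp (-(α * u - β / u) ^ 2) =
      (α + β / u ^ 2) * exp (-(α * u - β / u) ^ 2) := by
    intro u hu
    rw [abs_of_pos (by have := mem_Ioi.1 hu; positivity), smul_eq_mul]
  constructor
  · have h := (integrableOn_image_iff_integrableOn_abs_deriv_smul measurableSet_Ioi hd hinj
      (fun v => exp (-v ^ 2))).1 (by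
        rw [himg, integrableOn_univ]; simpa using integrable_exp_neg_mul_sq one_pos)
    exact h.congr_fun habs measurableSet_Ioi
  · have h := integral_image_eq_integral_abs_deriv_smul measurableSet_Ioi hd hinj
      (fun v => exp (-v ^ 2))
    rw [himg, setIntegral_univ, setIntegral_congr_fun measurableSet_Ioi habs] at h
    rw [← h]
    simpa using integral_gaussian 1

theorem integral_Ioi_comp_sub_div_symm (α β : ℝ) (hα : 0 < α) (hβ : 0 < β) :
    ∫ u in Ioi (0 : ℝ), β / u ^ 2 * exp (-(α * u - β / u) ^ 2) =
      ∫ u in Ioi (0 : ℝ), α * exp (-(α * u - β / u) ^ 2) := by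
  have hd : ∀ u ∈ Ioi (0 : ℝ),
      HasDerivWithinAt (fun u : ℝ => β / (α * u)) (-(β / (α * u ^ 2))) (Ioi 0) u := by
    intro u hu
    have hu' : u ≠ 0 := (mem_Ioi.1 hu).ne'
    have h := (hasDerivAt_inv hu').const_mul (β / α)
    refine ((h.congr_deriv ?_).congr_of_eventuallyEq ?_).hasDerivWithinAt
    · field_simp
    · filter_upwards with v
      rw [← div_div, div_eq_mul_inv]
  have hinj : InjOn (fun u : ℝ => β / (α * u)) (Ioi 0) := by
    intro u hu v hv h
    have hu' : 0 < u := hu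
    have hv' : 0 < v := hv
    have h' : β / (α * u) = β / (α * v) := h
    field_simp at h'
    exact h'.symm
  have himg : Set.image (fun u : ℝ => β / (α * u)) (Ioi 0) = Ioi 0 := by
    ext v
    constructor
    · rintro ⟨u, hu, rfl⟩
      have hu' : 0 < u := hu
      exact mem_Ioi.2 (by positivity)
    · intro hv
      have hv' : 0 < v := hv
      refine ⟨β / (α * v), mem_Ioi.2 (by positivity), ?_⟩
      change β / (α * (β / (α * v))) = v
      field_simp
  have h := integral_image_eq_integral_abs_deriv_smul measurableSet_Ioi hd hinj
      (fun u => α * exp (-(α * u - β / u) ^ 2))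
  rw [himg] at h
  rw [h]
  refine setIntegral_congr_fun measurableSet_Ioi fun u hu => ?_
  have hu' : 0 < u := hu
  have e : α * (β / (α * u)) - β / (β / (α * u)) = -(α * u - β / u) := by
    field_simp
    ring
  simp only [e, abs_neg, neg_sq, smul_eq_mul]
  rw [abs_of_pos (by positivity)]
  field_simp

theorem exp_neg_sq_sub_sq (α β u : ℝ) (hu : u ≠ 0) :
    exp (-(α * u) ^ 2 - (β / u) ^ 2) = exp (-(2 * α * β)) * exp (-(α * u - β / u) ^ 2) := by
  rw [← Real.exp_add]
  congr 1
  field_simp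
  ring

theorem integrableOn_pow_mul_exp_neg_sq_sub_sq (α β : ℝ) (hα : 0 < α) (n : ℕ) :
    IntegrableOn (fun u : ℝ => u ^ n * exp (-(α * u) ^ 2 - (β / u) ^ 2)) (Ioi 0) := by
  have h := integrableOn_rpow_mul_exp_neg_mul_sq (b := α ^ 2) (by positivity)
    (s := n) (by have : (0 : ℝ) ≤ n := n.cast_nonneg; linarith)
  refine Integrable.mono' h (by fun_prop) ?_
  filter_upwards [ae_restrict_mem measurableSet_Ioi] with u hu
  have hu' : 0 < u := hu
  rw [norm_of_nonneg (by positivity), rpow_natCast]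
  gcongr
  nlinarith [sq_nonneg (β / u)]

theorem integrableOn_exp_neg_sq_sub (α β : ℝ) (hα : 0 < α) :
    IntegrableOn (fun u : ℝ => exp (-(α * u - β / u) ^ 2)) (Ioi 0) := by
  have h := (integrableOn_pow_mul_exp_neg_sq_sub_sq α β hα 0).const_mul (exp (2 * α * β))
  refine IntegrableOn.congr_fun h (fun u hu => ?_) measurableSet_Ioi
  rw [exp_neg_sq_sub_sq α β u (mem_Ioi.1 hu).ne', pow_zero, one_mul, ← mul_assoc,
    ← Real.exp_add, add_neg_cancel, Real.exp_zero, one_mul]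

theorem integral_exp_neg_sq_sub_sq (α β : ℝ) (hα : 0 < α) (hβ : 0 ≤ β) :
    ∫ u in Ioi (0 : ℝ), exp (-(α * u) ^ 2 - (β / u) ^ 2) =
      √π / (2 * α) * exp (-(2 * α * β)) := by
  rcases hβ.eq_or_lt with rfl | hβ
  · have h := integral_gaussian_Ioi (α ^ 2)
    rw [Real.sqrt_div pi_pos.le, Real.sqrt_sq hα.le] at h
    simp only [zero_div, mul_zero, neg_zero, Real.exp_zero, mul_one]
    rw [mul_comm 2 α, ← div_div, ← h]
    refine setIntegral_congr_fun measurableSet_Ioi fun u _ => ?_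
    congr 1
    ring
  · obtain ⟨hi, hI⟩ := integral_Ioi_comp_sub_div α β hα hβ
    have h0 : IntegrableOn (fun u : ℝ => α * exp (-(α * u - β / u) ^ 2)) (Ioi 0) :=
      (integrableOn_exp_neg_sq_sub α β hα).const_mul α
    have h1 : IntegrableOn (fun u : ℝ => β / u ^ 2 * exp (-(α * u - β / u) ^ 2)) (Ioi 0) :=
      (hi.sub h0).congr_fun (fun u _ => by simp only [Pi.sub_apply]; ring) measurableSet_Ioi
    have hs : √π = (∫ u in Ioi (0 : ℝ), α * exp (-(α * u - β / u) ^ 2)) +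
        ∫ u in Ioi (0 : ℝ), β / u ^ 2 * exp (-(α * u - β / u) ^ 2) := by
      rw [← integral_add h0 h1, ← hI]
      simp only [add_mul]
    rw [integral_Ioi_comp_sub_div_symm α β hα hβ, integral_const_mul] at hs
    rw [setIntegral_congr_fun measurableSet_Ioi
      fun u hu => exp_neg_sq_sub_sq α β u (mem_Ioi.1 hu).ne', integral_const_mul]
    rw [hs]
    field_simp
    ring

theorem integral_div_sq_mul_exp_neg_sq_sub_sq (α β : ℝ) (hα : 0 < α) (hβ : 0 ≤ β) :
    IntegrableOn (fun u : ℝ => β ^ 2 / u ^ 2 * exp (-(α * u) ^ 2 - (β / u) ^ 2)) (Ioi 0) ∧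
    ∫ u in Ioi (0 : ℝ), β ^ 2 / u ^ 2 * exp (-(α * u) ^ 2 - (β / u) ^ 2) =
      β * √π / 2 * exp (-(2 * α * β)) := by
  rcases hβ.eq_or_lt with rfl | hβ
  · simp
  have hE : EqOn (fun u : ℝ => β * exp (-(2 * α * β)) *
        (β / u ^ 2 * exp (-(α * u - β / u) ^ 2)))
      (fun u : ℝ => β ^ 2 / u ^ 2 * exp (-(α * u) ^ 2 - (β / u) ^ 2)) (Ioi 0) := by
    intro u hu
    change _ = β ^ 2 / u ^ 2 * exp (-(α * u) ^ 2 - (β / u) ^ 2)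
    rw [exp_neg_sq_sub_sq α β u (mem_Ioi.1 hu).ne']
    ring
  have h0 : IntegrableOn (fun u : ℝ => α * exp (-(α * u - β / u) ^ 2)) (Ioi 0) :=
    (integrableOn_exp_neg_sq_sub α β hα).const_mul α
  have h1 : IntegrableOn (fun u : ℝ => β / u ^ 2 * exp (-(α * u - β / u) ^ 2)) (Ioi 0) :=
    ((integral_Ioi_comp_sub_div α β hα hβ).1.sub h0).congr_fun
      (fun u _ => by simp only [Pi.sub_apply]; ring) measurableSet_Ioi
  refine ⟨IntegrableOn.congr_fun (h1.const_mul _) hE measurableSet_Ioi, ?_⟩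
  have hg := integral_exp_neg_sq_sub_sq α β hα hβ.le
  rw [setIntegral_congr_fun measurableSet_Ioi
      fun u hu => exp_neg_sq_sub_sq α β u (mem_Ioi.1 hu).ne', integral_const_mul] at hg
  rw [← setIntegral_congr_fun measurableSet_Ioi hE, integral_const_mul,
    integral_Ioi_comp_sub_div_symm α β hα hβ, integral_const_mul]
  calc _ = β * α * (exp (-(2 * α * β)) * ∫ u in Ioi (0 : ℝ), exp (-(α * u - β / u) ^ 2)) := by ring
    _ = _ := by
      rw [hg]
      field_simp

theorem integral_sq_mul_exp_neg_sq_sub_sq (α β : ℝ) (hα : 0 < α) (hβ : 0 ≤ β) :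
    ∫ u in Ioi (0 : ℝ), u ^ 2 * exp (-(α * u) ^ 2 - (β / u) ^ 2) =
      √π * (1 / (4 * α ^ 3) + β / (2 * α ^ 2)) * exp (-(2 * α * β)) := by
  set e : ℝ → ℝ := fun u => exp (-(α * u) ^ 2 - (β / u) ^ 2) with he
  have i0 : IntegrableOn e (Ioi 0) := by
    simpa using integrableOn_pow_mul_exp_neg_sq_sub_sq α β hα 0
  have i2 : IntegrableOn (fun u => 2 * α ^ 2 * (u ^ 2 * e u)) (Ioi 0) :=
    (integrableOn_pow_mul_exp_neg_sq_sub_sq α β hα 2).const_mul _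
  obtain ⟨im, hm⟩ := integral_div_sq_mul_exp_neg_sq_sub_sq α β hα hβ
  have im' : IntegrableOn (fun u => 2 * (β ^ 2 / u ^ 2 * e u)) (Ioi 0) := im.const_mul 2
  have hbound : ∀ u : ℝ, |u * e u| ≤ |u * exp (-α ^ 2 * u ^ 2)| := by
    intro u
    rw [abs_mul, abs_mul]
    refine mul_le_mul_of_nonneg_left ?_ (abs_nonneg u)
    rw [abs_of_pos (exp_pos _), abs_of_pos (exp_pos _)]
    exact exp_le_exp.2 (by nlinarith [sq_nonneg (β / u)])
  have hftc : ∫ u in Ioi (0 : ℝ), (e u - 2 * α ^ 2 * (u ^ 2 * e u) +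
      2 * (β ^ 2 / u ^ 2 * e u)) = 0 - 0 * e 0 := by
    refine integral_Ioi_of_hasDerivAt_of_tendsto (f := fun u => u * e u) ?_ ?_
      ((i0.sub i2).add im') ?_
    · refine ContinuousAt.continuousWithinAt ?_
      have h : Filter.Tendsto (fun u : ℝ => |u * exp (-α ^ 2 * u ^ 2)|) (nhds 0) (nhds 0) := by
        have : Continuous fun u : ℝ => |u * exp (-α ^ 2 * u ^ 2)| := by fun_prop
        simpa using this.tendsto 0
      change Filter.Tendsto _ _ _
      simpa using squeeze_zero_norm hbound h
    · intro u hu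
      have hu' : u ≠ 0 := (mem_Ioi.1 hu).ne'
      have h1 : HasDerivAt (fun u : ℝ => -(α * u) ^ 2 - (β / u) ^ 2)
          (-(2 * α ^ 2 * u) + 2 * β ^ 2 / u ^ 3) u := by
        have ha := (((hasDerivAt_id u).const_mul α).pow 2).neg
        have hb := ((hasDerivAt_inv hu').const_mul β).pow 2
        refine (ha.sub hb).congr_deriv ?_
        simp
        field_simp
      refine ((hasDerivAt_id u).mul h1.exp).congr_deriv ?_
      simp only [he, id]
      field_simp
      ring
    · have h := (tendsto_rpow_abs_mul_exp_neg_mul_sq_cocompact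
        (a := α ^ 2) (by positivity) 1).mono_left _root_.atTop_le_cocompact
      refine squeeze_zero_norm (fun u => (hbound u).trans_eq ?_) h
      rw [abs_mul, abs_of_pos (exp_pos _), rpow_one]
  have i02 : IntegrableOn (fun u => e u - 2 * α ^ 2 * (u ^ 2 * e u)) (Ioi 0) := i0.sub i2
  rw [integral_add i02 im', integral_sub i0 i2, integral_const_mul, integral_const_mul,
    hm, integral_exp_neg_sq_sub_sq α β hα hβ] at hftc
  change ∫ u in Ioi (0 : ℝ), u ^ 2 * e u = _
  generalize ∫ u in Ioi (0 : ℝ), u ^ 2 * e u = J at hftc ⊢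
  generalize exp (-(2 * α * β)) = E at hftc ⊢
  field_simp
  field_simp at hftc
  linarith

theorem integrable_prod_pow_mul_exp_neg_sq (n : ℕ) (z : ℝ) (hz : 0 < z) :
    Integrable (fun p : EuclideanSpace ℝ (Fin 2) × ℝ =>
        p.2 ^ (n + 2) * exp (-p.2 ^ 2 * (‖p.1‖ ^ 2 + z ^ 2)))
      ((volume : Measure (EuclideanSpace ℝ (Fin 2))).prod (volume.restrict (Ioi 0))) := by
  have hsplit : ∀ (x : EuclideanSpace ℝ (Fin 2)) (u : ℝ),
      u ^ (n + 2) * exp (-u ^ 2 * (‖x‖ ^ 2 + z ^ 2)) =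
        u ^ (n + 2) * exp (-z ^ 2 * u ^ 2) * exp (-u ^ 2 * ‖x‖ ^ 2) := by
    intro x u
    rw [mul_assoc, ← Real.exp_add]
    ring_nf
  refine (integrable_prod_iff' (by fun_prop)).2 ⟨?_, ?_⟩
  · filter_upwards [ae_restrict_mem measurableSet_Ioi] with u hu
    have hu' : 0 < u := hu
    simp only [hsplit]
    refine Integrable.const_mul ?_ _
    have h := (GaussianFourier.integrable_cexp_neg_mul_sq_norm_add (b := ((u ^ 2 : ℝ) : ℂ))
      (by rw [Complex.ofReal_re]; positivity) 0 (0 : EuclideanSpace ℝ (Fin 2))).norm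
    refine h.congr (ae_of_all _ fun x => ?_)
    simp [Complex.norm_exp, ← Complex.ofReal_pow]
  · have h := (integrableOn_rpow_mul_exp_neg_mul_sq (b := z ^ 2) (by positivity)
      (s := n) (by have : (0 : ℝ) ≤ n := n.cast_nonneg; linarith)).mul_const π
    refine IntegrableOn.congr_fun h (fun u hu => ?_) measurableSet_Ioi
    have hu' : 0 < u := hu
    have hn : ∀ x : EuclideanSpace ℝ (Fin 2),
        ‖u ^ (n + 2) * exp (-u ^ 2 * (‖x‖ ^ 2 + z ^ 2))‖ =
        u ^ (n + 2) * exp (-z ^ 2 * u ^ 2) * exp (-u ^ 2 * ‖x‖ ^ 2) := fun x => by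
      rw [← hsplit, norm_of_nonneg (by positivity)]
    simp only [hn]
    rw [integral_const_mul, GaussianFourier.integral_rexp_neg_mul_sq_norm (by positivity)]
    simp
    field_simp
    ring

theorem integrable_integral_pow_mul_exp_neg_sq (n : ℕ) (z : ℝ) (hz : 0 < z) :
    Integrable (fun x : EuclideanSpace ℝ (Fin 2) =>
      ∫ u in Ioi (0 : ℝ), u ^ (n + 2) * exp (-u ^ 2 * (‖x‖ ^ 2 + z ^ 2))) :=
  (integrable_prod_pow_mul_exp_neg_sq n z hz).integral_prod_left

theorem fourier_integral_pow_mul_exp_neg_sq (n : ℕ) (z : ℝ) (hz : 0 < z)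
    (ξ : EuclideanSpace ℝ (Fin 2)) :
    𝓕 (fun x : EuclideanSpace ℝ (Fin 2) =>
      ((∫ u in Ioi (0 : ℝ), u ^ (n + 2) * exp (-u ^ 2 * (‖x‖ ^ 2 + z ^ 2)) : ℝ) : ℂ)) ξ =
    ((π * ∫ u in Ioi (0 : ℝ), u ^ n * exp (-(z * u) ^ 2 - (π * ‖ξ‖ / u) ^ 2) : ℝ) : ℂ) := by
  have hint : Integrable (Function.uncurry fun (x : EuclideanSpace ℝ (Fin 2)) (u : ℝ) =>
      (𝐞 (-inner ℝ x ξ) : Circle) •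
        ((u ^ (n + 2) * exp (-u ^ 2 * (‖x‖ ^ 2 + z ^ 2)) : ℝ) : ℂ))
      ((volume : Measure (EuclideanSpace ℝ (Fin 2))).prod (volume.restrict (Ioi 0))) := by
    refine (integrable_prod_pow_mul_exp_neg_sq n z hz).mono ?_ (ae_of_all _ fun p => ?_)
    · refine Continuous.aestronglyMeasurable ?_
      simp only [Function.uncurry_def, Circle.smul_def, Real.fourierChar_apply]
      fun_prop
    · rw [Function.uncurry_def, Circle.norm_smul, Complex.norm_real]
  rw [Real.fourier_eq]
  simp only [← integral_complex_ofReal]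
  have hsm : ∀ x : EuclideanSpace ℝ (Fin 2),
      ((𝐞 (-inner ℝ x ξ) : Circle) • ∫ u in Ioi (0 : ℝ),
        ((u ^ (n + 2) * exp (-u ^ 2 * (‖x‖ ^ 2 + z ^ 2)) : ℝ) : ℂ)) =
      ∫ u in Ioi (0 : ℝ), (𝐞 (-inner ℝ x ξ) : Circle) •
        ((u ^ (n + 2) * exp (-u ^ 2 * (‖x‖ ^ 2 + z ^ 2)) : ℝ) : ℂ) := fun x => by
    simp only [Circle.smul_def, integral_smul]
  simp only [hsm]
  rw [integral_integral_swap hint, ← integral_const_mul, ← integral_complex_ofReal]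
  refine setIntegral_congr_fun measurableSet_Ioi fun u hu => ?_
  have hu' : 0 < u := hu
  have hg := fourier_gaussian_innerProductSpace (b := ((u ^ 2 : ℝ) : ℂ))
      (by rw [Complex.ofReal_re]; positivity) ξ
  rw [Real.fourier_eq] at hg
  have hx : ∀ x : EuclideanSpace ℝ (Fin 2), ((𝐞 (-inner ℝ x ξ) : Circle) •
        ((u ^ (n + 2) * exp (-u ^ 2 * (‖x‖ ^ 2 + z ^ 2)) : ℝ) : ℂ)) =
      ((u ^ (n + 2) * exp (-(z * u) ^ 2) : ℝ) : ℂ) *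
        ((𝐞 (-inner ℝ x ξ) : Circle) • Complex.exp (-((u ^ 2 : ℝ) : ℂ) * (‖x‖ : ℂ) ^ 2)) := by
    intro x
    have : -u ^ 2 * (‖x‖ ^ 2 + z ^ 2) = -(z * u) ^ 2 + -u ^ 2 * ‖x‖ ^ 2 := by ring
    rw [this, Real.exp_add]
    simp only [Circle.smul_def]
    push_cast
    simp only [smul_eq_mul]
    ring
  simp only [hx]
  rw [integral_const_mul, hg, sub_eq_add_neg, Real.exp_add]
  have hu0 : (u : ℂ) ≠ 0 := by exact_mod_cast hu'.ne'
  simp only [finrank_euclideanSpace_fin]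
  have h1 : ((2 : ℕ) : ℂ) / 2 = 1 := by norm_num
  have h2 : -(π : ℂ) ^ 2 * (‖ξ‖ : ℂ) ^ 2 / ((u ^ 2 : ℝ) : ℂ) = ((-(π * ‖ξ‖ / u) ^ 2 : ℝ) : ℂ) := by
    push_cast
    field_simp
  rw [h1, Complex.cpow_one, h2]
  push_cast
  field_simp
  ring

theorem integral_pow_two_mul_exp_neg_sq_mul (s : ℝ) (hs : 0 < s) :
    ∫ u in Ioi (0 : ℝ), u ^ (0 + 2) * exp (-u ^ 2 * s) = √π / 4 * (1 / √s ^ 3) := by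
  have h := integral_rpow_mul_exp_neg_mul_rpow (p := 2) (q := 2) two_pos (by norm_num) hs
  have hG : Gamma ((2 + 1) / 2) = 1 / 2 * √π := by
    rw [show ((2 : ℝ) + 1) / 2 = 1 / 2 + 1 by norm_num, Gamma_add_one (by norm_num),
      Gamma_one_half_eq]
  have hp : s ^ (-(2 + 1 : ℝ) / 2) = 1 / √s ^ 3 := by
    rw [Real.sqrt_eq_rpow, ← rpow_natCast, ← rpow_mul hs.le, one_div, ← rpow_neg hs.le]
    norm_num
  rw [hG, hp] at h
  rw [show √π / 4 * (1 / √s ^ 3) = 1 / √s ^ 3 * (1 / 2) * (1 / 2 * √π) by ring, ← h]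
  refine setIntegral_congr_fun measurableSet_Ioi fun u _ => ?_
  have e : u ^ (2 : ℝ) = u ^ 2 := by exact_mod_cast rpow_natCast u 2
  simp only [e]
  ring_nf

theorem integral_pow_four_mul_exp_neg_sq_mul (s : ℝ) (hs : 0 < s) :
    ∫ u in Ioi (0 : ℝ), u ^ (2 + 2) * exp (-u ^ 2 * s) = 3 * √π / 8 * (1 / √s ^ 5) := by
  have h := integral_rpow_mul_exp_neg_mul_rpow (p := 2) (q := 4) two_pos (by norm_num) hs
  have hG : Gamma ((4 + 1) / 2) = 3 / 4 * √π := by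
    rw [show ((4 : ℝ) + 1) / 2 = 1 / 2 + 1 + 1 by norm_num, Gamma_add_one (by norm_num), Gamma_add_one (by norm_num),
      Gamma_one_half_eq]
    ring
  have hp : s ^ (-(4 + 1 : ℝ) / 2) = 1 / √s ^ 5 := by
    rw [Real.sqrt_eq_rpow, ← rpow_natCast, ← rpow_mul hs.le, one_div, ← rpow_neg hs.le]
    norm_num
  rw [hG, hp] at h
  rw [show 3 * √π / 8 * (1 / √s ^ 5) = 1 / √s ^ 5 * (1 / 2) * (3 / 4 * √π) by ring, ← h]
  refine setIntegral_congr_fun measurableSet_Ioi fun u _ => ?_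
  have e : u ^ (4 : ℝ) = u ^ 4 := by exact_mod_cast rpow_natCast u 4
  simp only [e, rpow_two]
  ring_nf

theorem fourier_const_mul (c : ℂ) (f : EuclideanSpace ℝ (Fin 2) → ℂ)
    (ξ : EuclideanSpace ℝ (Fin 2)) : 𝓕 (fun x => c * f x) ξ = c * 𝓕 f ξ := by
  rw [Real.fourier_eq, Real.fourier_eq, ← integral_const_mul]
  refine integral_congr_ae (ae_of_all _ fun x => ?_)
  simp only [Circle.smul_def, smul_eq_mul]
  ring

theorem fourier_fun_sub {f g : EuclideanSpace ℝ (Fin 2) → ℂ} (hf : Integrable f) (hg : Integrable g)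
    (ξ : EuclideanSpace ℝ (Fin 2)) : 𝓕 (fun x => f x - g x) ξ = 𝓕 f ξ - 𝓕 g ξ := by
  rw [Real.fourier_eq, Real.fourier_eq, Real.fourier_eq, ← integral_sub
    ((Real.fourierIntegral_convergent_iff ξ).2 hf) ((Real.fourierIntegral_convergent_iff ξ).2 hg)]
  simp only [smul_sub]

theorem integrable_one_div_sqrt_pow_three (z : ℝ) (hz : 0 < z) :
    Integrable (fun x : EuclideanSpace ℝ (Fin 2) => 1 / √(‖x‖ ^ 2 + z ^ 2) ^ 3) := by
  have h := (integrable_integral_pow_mul_exp_neg_sq 0 z hz).const_mul (4 / √π)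
  refine h.congr (ae_of_all _ fun x => ?_)
  have : √π ≠ 0 := (Real.sqrt_pos.2 pi_pos).ne'
  simp only [integral_pow_two_mul_exp_neg_sq_mul (‖x‖ ^ 2 + z ^ 2) (by positivity)]
  field_simp

theorem integrable_one_div_sqrt_pow_five (z : ℝ) (hz : 0 < z) :
    Integrable (fun x : EuclideanSpace ℝ (Fin 2) => 1 / √(‖x‖ ^ 2 + z ^ 2) ^ 5) := by
  have h := (integrable_integral_pow_mul_exp_neg_sq 2 z hz).const_mul (8 / (3 * √π))
  refine h.congr (ae_of_all _ fun x => ?_)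
  have : √π ≠ 0 := (Real.sqrt_pos.2 pi_pos).ne'
  simp only [integral_pow_four_mul_exp_neg_sq_mul (‖x‖ ^ 2 + z ^ 2) (by positivity)]
  field_simp

theorem fourier_one_div_sqrt_pow_three (z : ℝ) (hz : 0 < z) (ξ : EuclideanSpace ℝ (Fin 2)) :
    𝓕 (fun x : EuclideanSpace ℝ (Fin 2) => ((1 / √(‖x‖ ^ 2 + z ^ 2) ^ 3 : ℝ) : ℂ)) ξ =
      ((2 * π / z * exp (-(2 * π * z * ‖ξ‖)) : ℝ) : ℂ) := by
  have hp : √π ≠ 0 := (Real.sqrt_pos.2 pi_pos).ne'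
  have h := fourier_integral_pow_mul_exp_neg_sq 0 z hz ξ
  have he : ∀ x : EuclideanSpace ℝ (Fin 2),
      ((1 / √(‖x‖ ^ 2 + z ^ 2) ^ 3 : ℝ) : ℂ) = ((4 / √π : ℝ) : ℂ) *
        ((∫ u in Ioi (0 : ℝ), u ^ (0 + 2) * exp (-u ^ 2 * (‖x‖ ^ 2 + z ^ 2)) : ℝ) : ℂ) := by
    intro x
    rw [integral_pow_two_mul_exp_neg_sq_mul (‖x‖ ^ 2 + z ^ 2) (by positivity),
      ← Complex.ofReal_mul]
    congr 1
    field_simp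
  simp only [he]
  rw [fourier_const_mul, h, ← Complex.ofReal_mul]
  simp only [pow_zero, one_mul]
  rw [integral_exp_neg_sq_sub_sq z (π * ‖ξ‖) hz (by positivity),
    show 2 * z * (π * ‖ξ‖) = 2 * π * z * ‖ξ‖ by ring]
  congr 1
  field_simp
  norm_num

theorem fourier_one_div_sqrt_pow_five (z : ℝ) (hz : 0 < z) (ξ : EuclideanSpace ℝ (Fin 2)) :
    𝓕 (fun x : EuclideanSpace ℝ (Fin 2) => ((1 / √(‖x‖ ^ 2 + z ^ 2) ^ 5 : ℝ) : ℂ)) ξ =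
      ((4 * π / 3 * (1 / (2 * z ^ 3) + π * ‖ξ‖ / z ^ 2) * exp (-(2 * π * z * ‖ξ‖)) : ℝ) : ℂ) := by
  have hp : √π ≠ 0 := (Real.sqrt_pos.2 pi_pos).ne'
  have h := fourier_integral_pow_mul_exp_neg_sq 2 z hz ξ
  have he : ∀ x : EuclideanSpace ℝ (Fin 2),
      ((1 / √(‖x‖ ^ 2 + z ^ 2) ^ 5 : ℝ) : ℂ) = ((8 / (3 * √π) : ℝ) : ℂ) *
        ((∫ u in Ioi (0 : ℝ), u ^ (2 + 2) * exp (-u ^ 2 * (‖x‖ ^ 2 + z ^ 2)) : ℝ) : ℂ) := by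
    intro x
    rw [integral_pow_four_mul_exp_neg_sq_mul (‖x‖ ^ 2 + z ^ 2) (by positivity),
      ← Complex.ofReal_mul]
    congr 1
    field_simp
  simp only [he]
  rw [fourier_const_mul, h, ← Complex.ofReal_mul,
    integral_sq_mul_exp_neg_sq_sub_sq z (π * ‖ξ‖) hz (by positivity),
    show 2 * z * (π * ‖ξ‖) = 2 * π * z * ‖ξ‖ by ring]
  congr 1
  field_simp
  ring

theorem hasFDerivAt_one_div_sqrt_pow_three (z : ℝ) (hz : 0 < z) (x : EuclideanSpace ℝ (Fin 2)) :
    HasFDerivAt (fun x : EuclideanSpace ℝ (Fin 2) => ((1 / √(‖x‖ ^ 2 + z ^ 2) ^ 3 : ℝ) : ℂ))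
      (Complex.ofRealCLM.comp ((-(3 / √(‖x‖ ^ 2 + z ^ 2) ^ 5)) • innerSL ℝ x)) x := by
  have hs : 0 < ‖x‖ ^ 2 + z ^ 2 := by positivity
  have hr : 0 < √(‖x‖ ^ 2 + z ^ 2) := Real.sqrt_pos.2 hs
  have h1 := ((hasStrictFDerivAt_norm_sq x).hasFDerivAt.add_const (z ^ 2)).sqrt hs.ne'
  have h2 := (hasDerivAt_zpow (-3) √(‖x‖ ^ 2 + z ^ 2) (Or.inl hr.ne')).comp_hasFDerivAt x h1
  have h3 := Complex.ofRealCLM.hasFDerivAt.comp x h2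
  refine (h3.congr_fderiv ?_).congr_of_eventuallyEq (Filter.Eventually.of_forall fun y => ?_)
  · ext v
    simp [zpow_neg]
    field_simp
  · simp [zpow_neg]

theorem norm_mul_le_sq_add_sq (z : ℝ) (x : EuclideanSpace ℝ (Fin 2)) :
    ‖x‖ * z ≤ √(‖x‖ ^ 2 + z ^ 2) ^ 2 := by
  rw [Real.sq_sqrt (by positivity)]
  nlinarith [sq_nonneg (‖x‖ - z), sq_nonneg (‖x‖ + z)]

theorem integrable_fderiv_one_div_sqrt_pow_three (z : ℝ) (hz : 0 < z) :
    Integrable (fderiv ℝ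
      (fun x : EuclideanSpace ℝ (Fin 2) => ((1 / √(‖x‖ ^ 2 + z ^ 2) ^ 3 : ℝ) : ℂ))) := by
  refine ((integrable_one_div_sqrt_pow_three z hz).const_mul (3 / z)).mono'
    (measurable_fderiv ℝ _).aestronglyMeasurable (ae_of_all _ fun x => ?_)
  have hr : 0 < √(‖x‖ ^ 2 + z ^ 2) := Real.sqrt_pos.2 (by positivity)
  rw [(hasFDerivAt_one_div_sqrt_pow_three z hz x).fderiv]
  refine ContinuousLinearMap.opNorm_le_bound _ (by positivity) fun v => ?_
  have h := norm_mul_le_sq_add_sq z x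
  simp only [ContinuousLinearMap.comp_apply, smul_apply, innerSL_apply_apply,
    Complex.ofRealCLM_apply, Complex.norm_real, norm_smul, norm_neg]
  rw [norm_of_nonneg (by positivity)]
  calc 3 / √(‖x‖ ^ 2 + z ^ 2) ^ 5 * ‖inner ℝ x v‖
      ≤ 3 / √(‖x‖ ^ 2 + z ^ 2) ^ 5 * (‖x‖ * ‖v‖) := by
        gcongr
        exact norm_inner_le_norm x v
    _ = 3 / √(‖x‖ ^ 2 + z ^ 2) ^ 5 / z * (‖x‖ * z) * ‖v‖ := by field_simp
    _ ≤ 3 / √(‖x‖ ^ 2 + z ^ 2) ^ 5 / z * √(‖x‖ ^ 2 + z ^ 2) ^ 2 * ‖v‖ := by gcongr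
    _ = _ := by field_simp

theorem coord_mul_div_sqrt_pow_five_eq_fderiv (z : ℝ) (hz : 0 < z) (i : Fin 2)
    (x : EuclideanSpace ℝ (Fin 2)) :
    ((3 * x i / √(‖x‖ ^ 2 + z ^ 2) ^ 5 : ℝ) : ℂ) =
      -fderiv ℝ (fun x : EuclideanSpace ℝ (Fin 2) => ((1 / √(‖x‖ ^ 2 + z ^ 2) ^ 3 : ℝ) : ℂ)) x
        (EuclideanSpace.single i 1) := by
  rw [(hasFDerivAt_one_div_sqrt_pow_three z hz x).fderiv]
  simp [EuclideanSpace.inner_single_right]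
  ring

theorem integrable_coord_mul_div_sqrt_pow_five (z : ℝ) (hz : 0 < z) (i : Fin 2) :
    Integrable (fun x : EuclideanSpace ℝ (Fin 2) =>
      ((3 * x i / √(‖x‖ ^ 2 + z ^ 2) ^ 5 : ℝ) : ℂ)) := by
  simp only [coord_mul_div_sqrt_pow_five_eq_fderiv z hz i]
  exact ((integrable_fderiv_one_div_sqrt_pow_three z hz).apply_continuousLinearMap _).neg

theorem norm_fourier_coord_mul_div_sqrt_pow_five (z : ℝ) (hz : 0 < z) (i : Fin 2)
    (ξ : EuclideanSpace ℝ (Fin 2)) :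
    ‖𝓕 (fun x : EuclideanSpace ℝ (Fin 2) =>
      ((3 * x i / √(‖x‖ ^ 2 + z ^ 2) ^ 5 : ℝ) : ℂ)) ξ‖ ≤
      4 * π ^ 2 / z * ‖ξ‖ * exp (-(2 * π * z * ‖ξ‖)) := by
  have hi := integrable_fderiv_one_div_sqrt_pow_three z hz
  have h3 := fourier_one_div_sqrt_pow_three z hz ξ
  have hd := Real.fourier_fderiv (integrable_one_div_sqrt_pow_three z hz).ofReal
    (fun x => (hasFDerivAt_one_div_sqrt_pow_three z hz x).differentiableAt) hi
  have he := congrArg (fun T => T (EuclideanSpace.single i 1)) (congrFun hd ξ)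
  rw [Real.fourier_continuousLinearMap_apply hi] at he
  simp only [coord_mul_div_sqrt_pow_five_eq_fderiv z hz i, neg_eq_neg_one_mul (fderiv ℝ _ _ _)]
  rw [fourier_const_mul, he]
  rw [VectorFourier.fourierSMulRight_apply, h3]
  have hc : ‖(-innerSL ℝ : EuclideanSpace ℝ (Fin 2) →L[ℝ] EuclideanSpace ℝ (Fin 2) →L[ℝ] ℝ) ξ
      (EuclideanSpace.single i 1)‖ ≤ ‖ξ‖ := by
    have h := norm_inner_le_norm (𝕜 := ℝ) ξ (EuclideanSpace.single i (1 : ℝ))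
    simpa using h
  simp only [norm_smul, norm_mul, norm_neg, norm_one, one_mul, Complex.norm_real,
    Complex.norm_I, mul_one, Complex.norm_ofNat]
  rw [← norm_mul (2 * π / z), norm_of_nonneg pi_pos.le,
    norm_of_nonneg (show 0 ≤ 2 * π / z * exp (-(2 * π * z * ‖ξ‖)) by positivity)]
  refine (mul_le_mul_of_nonneg_left
    (mul_le_mul_of_nonneg_right hc (by positivity)) (by positivity)).trans_eq ?_
  ring

end

/-- **Frequency decay of the dipolar Green-tensor channels (first part).**
For standoff `z₀ > 0` and constant `μ > 0`, let `R(x) = (x₁, x₂, z₀) ∈ ℝ³`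
and `G_a(x) = (μ/(4π)) · (3 R(x)_a z₀ − ‖R(x)‖² δ_{a3}) / ‖R(x)‖⁵` for each
channel `a`. Then each `G_a` is integrable on `ℝ²` and there is `C ≥ 0` with
`|𝓕 G_a (ξ)| ≤ C ‖ξ‖ e^{−2π z₀ ‖ξ‖}` for all `ξ`. -/
theorem green_channel_fourier_decay
    (z₀ μ : ℝ) (hz : 0 < z₀) (hμ : 0 < μ)
    (R : EuclideanSpace ℝ (Fin 2) → EuclideanSpace ℝ (Fin 3))
    (hR : ∀ x, R x = ![x 0, x 1, z₀])
    (G : Fin 3 → EuclideanSpace ℝ (Fin 2) → ℂ)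
    (hG : ∀ a x, G a x =
      ((μ / (4 * π)) * (3 * R x a * z₀ - ‖R x‖ ^ 2 * (if a = 2 then 1 else 0)) /
        ‖R x‖ ^ 5 : ℝ)) :
    (∀ a, Integrable (G a)) ∧
      ∃ C : ℝ, 0 ≤ C ∧ ∀ (a : Fin 3) (ξ : EuclideanSpace ℝ (Fin 2)),
        ‖𝓕 (G a) ξ‖ ≤ C * ‖ξ‖ * Real.exp (-(2 * π * z₀ * ‖ξ‖)) := by
  have hs : ∀ x : EuclideanSpace ℝ (Fin 2), ‖R x‖ = √(‖x‖ ^ 2 + z₀ ^ 2) := by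
    intro x
    rw [EuclideanSpace.norm_eq, EuclideanSpace.norm_sq_eq, hR]
    simp [Fin.sum_univ_three]
  have hr : ∀ x : EuclideanSpace ℝ (Fin 2), 0 < √(‖x‖ ^ 2 + z₀ ^ 2) := fun x =>
    Real.sqrt_pos.2 (by positivity)
  have hlat : ∀ (a : Fin 3) (i : Fin 2), a ≠ 2 → (∀ x, R x a = x i) → G a = fun x =>
      ((μ / (4 * π) * z₀ : ℝ) : ℂ) * ((3 * x i / √(‖x‖ ^ 2 + z₀ ^ 2) ^ 5 : ℝ) : ℂ) := by
    intro a i ha hRa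
    funext x
    rw [hG, hs, hRa, if_neg ha, ← Complex.ofReal_mul]
    congr 1
    ring
  have h0 := hlat 0 0 (by decide) fun x => by rw [hR]; rfl
  have h1 := hlat 1 1 (by decide) fun x => by rw [hR]; rfl
  have h2 : G 2 = fun x => ((μ / (4 * π) : ℝ) : ℂ) *
      (((3 * z₀ ^ 2 : ℝ) : ℂ) * ((1 / √(‖x‖ ^ 2 + z₀ ^ 2) ^ 5 : ℝ) : ℂ) -
        ((1 / √(‖x‖ ^ 2 + z₀ ^ 2) ^ 3 : ℝ) : ℂ)) := by
    funext x
    have hRa : R x 2 = z₀ := by rw [hR]; rfl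
    have := (hr x).ne'
    rw [hG, hs, hRa, if_pos rfl, ← Complex.ofReal_mul, ← Complex.ofReal_sub, ← Complex.ofReal_mul]
    congr 1
    field_simp
  have i3 : Integrable fun x : EuclideanSpace ℝ (Fin 2) =>
      ((1 / √(‖x‖ ^ 2 + z₀ ^ 2) ^ 3 : ℝ) : ℂ) := (integrable_one_div_sqrt_pow_three z₀ hz).ofReal
  have i5 : Integrable fun x : EuclideanSpace ℝ (Fin 2) => ((3 * z₀ ^ 2 : ℝ) : ℂ) *
      ((1 / √(‖x‖ ^ 2 + z₀ ^ 2) ^ 5 : ℝ) : ℂ) :=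
    (integrable_one_div_sqrt_pow_five z₀ hz).ofReal.const_mul _
  have hlatb : ∀ (i : Fin 2) (ξ : EuclideanSpace ℝ (Fin 2)),
      ‖𝓕 (fun x : EuclideanSpace ℝ (Fin 2) => ((μ / (4 * π) * z₀ : ℝ) : ℂ) *
        ((3 * x i / √(‖x‖ ^ 2 + z₀ ^ 2) ^ 5 : ℝ) : ℂ)) ξ‖ ≤
      μ * π * ‖ξ‖ * Real.exp (-(2 * π * z₀ * ‖ξ‖)) := by
    intro i ξ
    rw [fourier_const_mul, norm_mul, Complex.norm_real, norm_of_nonneg (by positivity)]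
    refine (mul_le_mul_of_nonneg_left (norm_fourier_coord_mul_div_sqrt_pow_five z₀ hz i ξ)
      (by positivity)).trans_eq ?_
    field_simp
  refine ⟨fun a => ?_, μ * π, by positivity, fun a ξ => ?_⟩
  · fin_cases a
    · exact h0 ▸ (integrable_coord_mul_div_sqrt_pow_five z₀ hz 0).const_mul _
    · exact h1 ▸ (integrable_coord_mul_div_sqrt_pow_five z₀ hz 1).const_mul _
    · exact h2 ▸ (i5.sub i3).const_mul _
  · fin_cases a
    · exact h0 ▸ hlatb 0 ξ
    · exact h1 ▸ hlatb 1 ξ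
    · change ‖𝓕 (G 2) ξ‖ ≤ _
      rw [h2, fourier_const_mul, fourier_fun_sub i5 i3, fourier_const_mul,
        fourier_one_div_sqrt_pow_five z₀ hz, fourier_one_div_sqrt_pow_three z₀ hz,
        ← Complex.ofReal_mul, ← Complex.ofReal_sub, ← Complex.ofReal_mul, Complex.norm_real]
      refine le_of_eq ?_
      rw [← norm_of_nonneg (show 0 ≤ μ * π * ‖ξ‖ * Real.exp (-(2 * π * z₀ * ‖ξ‖)) by positivity)]
      congr 1
      field_simp
      ring
end

section
/- Fix z₀ > 0 and a constant μ > 0, and for a ∈ {1, 2, 3} let G_a : ℝ² → ℝ be the dipolar Green-tensor channel G_a(x) = (μ / (4π)) · (3 · R(x)_a · z₀ − ‖R(x)‖² · δ_{a3}) / ‖R(x)‖⁵ with R(x) = (x₁, x₂, z₀). Then the pointwise square G_a² is integrable on ℝ², and there exist a constant C ≥ 0 and a natural number m such that for all ξ ∈ ℝ², |𝓕(G_a²)(ξ)| ≤ C · (1 + ‖ξ‖)^m · e^{−2π z₀ ‖ξ‖}, where 𝓕 denotes the Fourier transform on ℝ² with convention 𝓕f(ξ) = ∫ e^{−2πi⟨x,ξ⟩}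 f(x) dx. -/
open MeasureTheory Real
open scoped FourierTransform

/-- A function on `ℝ²` is integrable and its Fourier transform is bounded by a polynomial
times `exp (-2π z ‖ξ‖)`. -/
def FourierExpDecay (z : ℝ) (f : EuclideanSpace ℝ (Fin 2) → ℂ) : Prop :=
  Integrable f ∧ ∃ C : ℝ, 0 ≤ C ∧ ∃ m : ℕ, ∀ ξ,
    ‖𝓕 f ξ‖ ≤ C * (1 + ‖ξ‖) ^ m * Real.exp (-(2 * π * z * ‖ξ‖))

namespace FourierExpDecay

variable {z : ℝ} {f g : EuclideanSpace ℝ (Fin 2) → ℂ}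

theorem add (hf : FourierExpDecay z f) (hg : FourierExpDecay z g) :
    FourierExpDecay z (fun x => f x + g x) := by
  obtain ⟨hfi, C, hC, m, hCm⟩ := hf
  obtain ⟨hgi, D, hD, n, hDn⟩ := hg
  refine ⟨hfi.add hgi, C + D, by positivity, m + n, fun ξ => ?_⟩
  have key : 𝓕 (fun x => f x + g x) ξ = 𝓕 f ξ + 𝓕 g ξ := by
    simp only [Real.fourier_eq, smul_add]
    exact integral_add ((Real.fourierIntegral_convergent_iff ξ).2 hfi)
      ((Real.fourierIntegral_convergent_iff ξ).2 hgi)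
  have h1 : (1 : ℝ) ≤ 1 + ‖ξ‖ := by linarith [norm_nonneg ξ]
  calc ‖𝓕 (fun x => f x + g x) ξ‖ ≤ ‖𝓕 f ξ‖ + ‖𝓕 g ξ‖ := key ▸ norm_add_le _ _
    _ ≤ C * (1 + ‖ξ‖) ^ m * Real.exp (-(2 * π * z * ‖ξ‖)) +
        D * (1 + ‖ξ‖) ^ n * Real.exp (-(2 * π * z * ‖ξ‖)) := add_le_add (hCm ξ) (hDn ξ)
    _ ≤ C * (1 + ‖ξ‖) ^ (m + n) * Real.exp (-(2 * π * z * ‖ξ‖)) +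
        D * (1 + ‖ξ‖) ^ (m + n) * Real.exp (-(2 * π * z * ‖ξ‖)) := by
      gcongr <;> first | exact h1 | omega
    _ = _ := by ring

theorem const_mul (hf : FourierExpDecay z f) (c : ℂ) : FourierExpDecay z (fun x => c * f x) := by
  obtain ⟨hfi, C, hC, m, hCm⟩ := hf
  refine ⟨hfi.const_mul c, ‖c‖ * C, by positivity, m, fun ξ => ?_⟩
  have key : 𝓕 (fun x => c * f x) ξ = c * 𝓕 f ξ := by
    simp only [Real.fourier_eq, ← integral_const_mul, mul_smul_comm]
  calc ‖𝓕 (fun x => c * f x) ξ‖ = ‖c‖ * ‖𝓕 f ξ‖ := by rw [key, norm_mul]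
    _ ≤ ‖c‖ * (C * (1 + ‖ξ‖) ^ m * Real.exp (-(2 * π * z * ‖ξ‖))) := by gcongr; exact hCm ξ
    _ = _ := by ring

theorem of_hasLineDerivAt (hf : FourierExpDecay z f) (hg : Integrable g)
    (v : EuclideanSpace ℝ (Fin 2)) (hfg : ∀ x, HasLineDerivAt ℝ f (g x) x v) :
    FourierExpDecay z g := by
  obtain ⟨hfi, C, hC, m, hCm⟩ := hf
  refine ⟨hg, 2 * π * ‖v‖ * C, by positivity, m + 1, fun ξ => ?_⟩
  let e : EuclideanSpace ℝ (Fin 2) → ℂ := fun x => 𝐞 (-inner ℝ x ξ)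
  let c : ℂ := -2 * π * Complex.I * inner ℝ v ξ
  have he : ∀ x, HasLineDerivAt ℝ e (c * e x) x v := fun x => by
    have h : HasDerivAt (fun t : ℝ => Complex.exp
        ((2 * π * Complex.I) * -((inner ℝ x ξ : ℝ) + t * (inner ℝ v ξ : ℝ) : ℂ)))
        (Complex.exp ((2 * π * Complex.I) *
          -((inner ℝ x ξ : ℝ) + (0 : ℝ) * (inner ℝ v ξ : ℝ) : ℂ)) *
          ((2 * π * Complex.I) * -(1 * (inner ℝ v ξ : ℝ) : ℂ))) (0 : ℝ) := by
      refine HasDerivAt.cexp (HasDerivAt.const_mul _ (HasDerivAt.neg (HasDerivAt.const_add _ ?_)))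
      exact (Complex.ofRealCLM.hasDerivAt (x := (0 : ℝ))).mul_const _
    unfold HasLineDerivAt
    convert! h using 1
    · ext t
      simp only [e, Real.fourierChar_apply, inner_add_left, real_inner_smul_left]
      push_cast; ring_nf
    · simp only [e, c, Real.fourierChar_apply]
      push_cast; ring_nf
  have hfe : Integrable (fun x => e x * f x) :=
    (Real.fourierIntegral_convergent_iff ξ).2 hfi
  have hge : Integrable (fun x => e x * g x) :=
    (Real.fourierIntegral_convergent_iff ξ).2 hg
  have hce : Integrable (fun x => c * e x * f x) := by
    simpa only [mul_assoc] using hfe.const_mul c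
  have ibp : ∫ x, e x * g x = - ∫ x, c * e x * f x :=
    integral_bilinear_hasLineDerivAt_right_eq_neg_left_of_integrable
      (B := ContinuousLinearMap.mul ℝ ℂ) (v := v) hce hge hfe (fun x _ => he x) (fun x _ => hfg x)
  have key : 𝓕 g ξ = - (c * 𝓕 f ξ) := by
    simp only [mul_assoc, integral_const_mul] at ibp
    exact ibp
  have hc : ‖c‖ ≤ 2 * π * ‖v‖ * ‖ξ‖ := by
    have : ‖c‖ = 2 * π * |inner ℝ v ξ| := by
      simp [c, abs_of_pos pi_pos]
    rw [this, mul_assoc _ ‖v‖]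
    gcongr
    exact abs_real_inner_le_norm v ξ
  calc ‖𝓕 g ξ‖ = ‖c‖ * ‖𝓕 f ξ‖ := by rw [key, norm_neg, norm_mul]
    _ ≤ (2 * π * ‖v‖ * (1 + ‖ξ‖)) *
        (C * (1 + ‖ξ‖) ^ m * Real.exp (-(2 * π * z * ‖ξ‖))) := by
      gcongr
      · exact hc.trans (by gcongr; linarith)
      · exact hCm ξ
    _ = _ := by ring

end FourierExpDecay

theorem integral_pow_mul_exp_neg_mul_Ioi (n : ℕ) {r : ℝ} (hr : 0 < r) :
    ∫ t in Set.Ioi (0 : ℝ), t ^ n * Real.exp (-(r * t)) = n.factorial / r ^ (n + 1) := by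
  have h := Real.integral_rpow_mul_exp_neg_mul_Ioi (a := n + 1) (by positivity) hr
  rw [Real.Gamma_nat_eq_factorial] at h
  have h2 : (1 / r) ^ ((n : ℝ) + 1) = 1 / r ^ (n + 1) := by
    rw [← Nat.cast_succ, rpow_natCast, one_div_pow]
  rw [h2] at h
  simp only [add_sub_cancel_right, rpow_natCast] at h
  rw [h]; ring

theorem integrableOn_pow_mul_exp_neg_mul_Ioi (n : ℕ) {r : ℝ} (hr : 0 < r) :
    IntegrableOn (fun t : ℝ => t ^ n * Real.exp (-(r * t))) (Set.Ioi 0) :=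
  .of_integral_ne_zero (by rw [integral_pow_mul_exp_neg_mul_Ioi n hr]; positivity)

/-- Trading a small part of the exponential rate in `t` for a bounded factor in AM-GM. -/
theorem exp_neg_mul_mul_exp_neg_div_le {z s t : ℝ} (hz : 0 < z) (hs : 0 ≤ s) (ht : 0 < t) :
    Real.exp (-(z ^ 2 * t)) * Real.exp (-(π ^ 2 * s ^ 2 / t)) ≤
      Real.exp (2 * π * z) * Real.exp (-(2 * π * z * s)) *
        Real.exp (-(z ^ 2 / (1 + s) * t)) := by
  rw [← Real.exp_add, ← Real.exp_add, ← Real.exp_add, Real.exp_le_exp]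
  set w := s / (1 + s) with hw
  have h1 : (0 : ℝ) < 1 + s := by linarith
  have hw0 : 0 ≤ w := by positivity
  have hw1 : w ≤ 1 := (div_le_one h1).2 (by linarith)
  have e1 : z ^ 2 / (1 + s) = z ^ 2 * (1 - w) := by rw [hw]; field_simp; ring
  have e2 : s - 1 ≤ s * w := by
    have : s * w = s - w := by rw [hw]; field_simp; ring
    linarith
  have e3 : 2 * π * z * (s * w) ≤ z ^ 2 * t * w ^ 2 + π ^ 2 * s ^ 2 / t := by
    have : z ^ 2 * t * w ^ 2 + π ^ 2 * s ^ 2 / t - 2 * π * z * (s * w) =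
        (z * t * w - π * s) ^ 2 / t := by field_simp; ring
    have h3 : 0 ≤ (z * t * w - π * s) ^ 2 / t := by positivity
    linarith
  have e4 : z ^ 2 * t * w ^ 2 ≤ z ^ 2 * t * w :=
    mul_le_mul_of_nonneg_left (by nlinarith) (by positivity)
  have e5 : 2 * π * z * (s - 1) ≤ 2 * π * z * (s * w) :=
    mul_le_mul_of_nonneg_left e2 (by have := pi_pos; positivity)
  rw [e1]
  linarith

theorem fourier_gaussian_plane {t : ℝ} (ht : 0 < t) (ξ : EuclideanSpace ℝ (Fin 2)) :
    𝓕 (fun x : EuclideanSpace ℝ (Fin 2) => (Real.exp (-(t * ‖x‖ ^ 2)) : ℂ)) ξ =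
      ((π / t * Real.exp (-(π ^ 2 * ‖ξ‖ ^ 2 / t)) : ℝ) : ℂ) := by
  have h := fourier_gaussian_innerProductSpace (V := EuclideanSpace ℝ (Fin 2)) (b := t)
    (by simpa using ht) ξ
  rw [finrank_euclideanSpace, Fintype.card_fin, Nat.cast_ofNat,
    div_self (two_ne_zero : (2 : ℂ) ≠ 0), Complex.cpow_one] at h
  push_cast
  simpa only [neg_mul, neg_div] using h

theorem integrable_gaussian_plane {t : ℝ} (ht : 0 < t) :
    Integrable (fun x : EuclideanSpace ℝ (Fin 2) => Real.exp (-(t * ‖x‖ ^ 2))) := by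
  have h := (GaussianFourier.integrable_cexp_neg_mul_sq_norm_add
    (V := EuclideanSpace ℝ (Fin 2)) (b := t) (by simpa using ht) 0 0).re
  convert! h using 2 with x
  simp [← Complex.ofReal_pow, ← Complex.ofReal_mul, ← Complex.ofReal_neg, Complex.exp_ofReal_re]

theorem integral_gaussian_plane {t : ℝ} (ht : 0 < t) :
    ∫ x : EuclideanSpace ℝ (Fin 2), Real.exp (-(t * ‖x‖ ^ 2)) = π / t := by
  simpa using GaussianFourier.integral_rexp_neg_mul_sq_norm (V := EuclideanSpace ℝ (Fin 2)) ht

theorem integrable_pow_mul_exp_prod (n : ℕ) {z : ℝ} (hz : 0 < z) :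
    Integrable (fun p : EuclideanSpace ℝ (Fin 2) × ℝ =>
      p.2 ^ (n + 1) * Real.exp (-((‖p.1‖ ^ 2 + z ^ 2) * p.2)))
      (volume.prod (volume.restrict (Set.Ioi 0))) := by
  rw [integrable_prod_iff' (by fun_prop)]
  have split : ∀ (x : EuclideanSpace ℝ (Fin 2)) (t : ℝ),
      t ^ (n + 1) * Real.exp (-((‖x‖ ^ 2 + z ^ 2) * t)) =
      t ^ (n + 1) * Real.exp (-(z ^ 2 * t)) * Real.exp (-(t * ‖x‖ ^ 2)) := fun x t => by
    rw [mul_assoc, ← Real.exp_add]; ring_nf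
  constructor
  · filter_upwards [ae_restrict_mem measurableSet_Ioi] with t ht
    simp only [split]
    exact (integrable_gaussian_plane ht).const_mul _
  · refine ((integrableOn_pow_mul_exp_neg_mul_Ioi n (pow_pos hz 2)).const_mul π).congr ?_
    filter_upwards [ae_restrict_mem measurableSet_Ioi] with t ht
    have ht' : 0 < t := ht
    have hn : ∀ x : EuclideanSpace ℝ (Fin 2),
        ‖t ^ (n + 1) * Real.exp (-((‖x‖ ^ 2 + z ^ 2) * t))‖ =
        t ^ (n + 1) * Real.exp (-(z ^ 2 * t)) * Real.exp (-(t * ‖x‖ ^ 2)) := fun x => by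
      rw [Real.norm_of_nonneg (by positivity), split]
    simp only [hn, integral_const_mul, integral_gaussian_plane ht']
    field_simp
    ring

theorem fourierExpDecay_inv_pow (n : ℕ) {z : ℝ} (hz : 0 < z) :
    FourierExpDecay z (fun x => (((‖x‖ ^ 2 + z ^ 2)⁻¹ ^ (n + 2) : ℝ) : ℂ)) := by
  have hint := integrable_pow_mul_exp_prod n hz
  let H : EuclideanSpace ℝ (Fin 2) → ℝ → ℝ :=
    fun x t => t ^ (n + 1) * Real.exp (-((‖x‖ ^ 2 + z ^ 2) * t))
  let N : ℝ := (n + 1).factorial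
  have hN : 0 < N := by positivity
  have hrep : ∀ x, (‖x‖ ^ 2 + z ^ 2)⁻¹ ^ (n + 2) = N⁻¹ * ∫ t in Set.Ioi 0, H x t := fun x => by
    rw [integral_pow_mul_exp_neg_mul_Ioi (n + 1) (by positivity)]
    simp only [N, inv_pow]
    field_simp
  have hI : Integrable (fun x : EuclideanSpace ℝ (Fin 2) =>
      (‖x‖ ^ 2 + z ^ 2)⁻¹ ^ (n + 2)) := by
    simp only [hrep]
    exact hint.integral_prod_left.const_mul _
  refine ⟨hI.ofReal, N⁻¹ * π * Real.exp (2 * π * z) * n.factorial / (z ^ 2) ^ (n + 1),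
    by have := pi_pos; positivity, n + 1, fun ξ => ?_⟩
  let e : EuclideanSpace ℝ (Fin 2) → ℂ := fun x => 𝐞 (-inner ℝ x ξ)
  have hec : Continuous e := by
    simp only [e, Real.fourierChar_apply]; fun_prop
  have hint' : Integrable (fun p : EuclideanSpace ℝ (Fin 2) × ℝ => e p.1 * (H p.1 p.2 : ℂ))
      (volume.prod (volume.restrict (Set.Ioi 0))) :=
    hint.ofReal.bdd_mul (c := 1) (hec.comp continuous_fst).aestronglyMeasurable
      (by filter_upwards with p; exact (Circle.norm_coe _).le)
  have hF : 𝓕 (fun x : EuclideanSpace ℝ (Fin 2) => (((‖x‖ ^ 2 + z ^ 2)⁻¹ ^ (n + 2) : ℝ) : ℂ)) ξ =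
      N⁻¹ * ∫ t in Set.Ioi 0, ∫ x, e x * (H x t : ℂ) := by
    rw [← integral_integral_swap hint', ← integral_const_mul, Real.fourier_eq]
    congr 1
    ext x
    rw [hrep x, integral_const_mul, integral_complex_ofReal, Circle.smul_def, smul_eq_mul]
    push_cast
    ring
  have hin : ∀ t : ℝ, 0 < t → ‖∫ x, e x * (H x t : ℂ)‖ ≤
      π * Real.exp (2 * π * z) * Real.exp (-(2 * π * z * ‖ξ‖)) *
        (t ^ n * Real.exp (-(z ^ 2 / (1 + ‖ξ‖) * t))) := fun t ht => by
    have h1 : ∫ x, e x * (H x t : ℂ) = ((t ^ (n + 1) * Real.exp (-(z ^ 2 * t)) *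
        (π / t * Real.exp (-(π ^ 2 * ‖ξ‖ ^ 2 / t))) : ℝ) : ℂ) := by
      rw [Complex.ofReal_mul, ← fourier_gaussian_plane ht, Real.fourier_eq, ← integral_const_mul]
      congr 1
      ext x
      have : H x t = t ^ (n + 1) * Real.exp (-(z ^ 2 * t)) * Real.exp (-(t * ‖x‖ ^ 2)) := by
        simp only [H]
        rw [mul_assoc, ← Real.exp_add]; ring_nf
      rw [this, Circle.smul_def, smul_eq_mul]
      push_cast
      ring
    have hp := pi_pos
    rw [h1, Complex.norm_real, Real.norm_of_nonneg (by positivity)]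
    calc _ = π * t ^ n * (Real.exp (-(z ^ 2 * t)) * Real.exp (-(π ^ 2 * ‖ξ‖ ^ 2 / t))) := by
          rw [pow_succ]; field_simp
      _ ≤ π * t ^ n * (Real.exp (2 * π * z) * Real.exp (-(2 * π * z * ‖ξ‖)) *
          Real.exp (-(z ^ 2 / (1 + ‖ξ‖) * t))) := by
        gcongr ?_ * ?_
        exact exp_neg_mul_mul_exp_neg_div_le hz (norm_nonneg ξ) ht
      _ = _ := by ring
  have hε : 0 < z ^ 2 / (1 + ‖ξ‖) := by positivity
  calc _ = N⁻¹ * ‖∫ t in Set.Ioi 0, ∫ x, e x * (H x t : ℂ)‖ := by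
        rw [hF, norm_mul, Complex.norm_of_nonneg (by positivity)]
    _ ≤ N⁻¹ * ∫ t in Set.Ioi 0, π * Real.exp (2 * π * z) * Real.exp (-(2 * π * z * ‖ξ‖)) *
        (t ^ n * Real.exp (-(z ^ 2 / (1 + ‖ξ‖) * t))) := by
      gcongr
      refine norm_integral_le_of_norm_le
        ((integrableOn_pow_mul_exp_neg_mul_Ioi n hε).const_mul _) ?_
      filter_upwards [ae_restrict_mem measurableSet_Ioi] with t ht using hin t ht
    _ = _ := by
      rw [integral_const_mul, integral_pow_mul_exp_neg_mul_Ioi n hε, div_pow]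
      have : 0 < 1 + ‖ξ‖ := by positivity
      field_simp

theorem hasLineDerivAt_norm_sq_add_inv_pow (n : ℕ) {z : ℝ} (hz : 0 < z)
    (x v : EuclideanSpace ℝ (Fin 2)) :
    HasLineDerivAt ℝ (fun x => (‖x‖ ^ 2 + z ^ 2)⁻¹ ^ n)
      (-(2 * n) * inner ℝ x v * (‖x‖ ^ 2 + z ^ 2)⁻¹ ^ (n + 1)) x v := by
  have h0 : ‖x‖ ^ 2 + z ^ 2 ≠ 0 := by positivity
  have h := (((hasStrictFDerivAt_norm_sq x).hasFDerivAt.add_const (z ^ 2)).hasLineDerivAt v)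
  have h' : HasDerivAt (fun t : ℝ => ‖x + t • v‖ ^ 2 + z ^ 2) (2 * inner ℝ x v) 0 := by
    simpa [HasLineDerivAt] using h
  have h2 := (h'.fun_inv (by simpa using h0)).fun_pow n
  unfold HasLineDerivAt
  convert! h2 using 1
  rcases n with _ | n
  · simp
  · simp only [zero_smul, add_zero, Nat.add_sub_cancel]
    simp only [inv_pow]
    push_cast
    field_simp
    ring

theorem fourierExpDecay_coord_sq_mul_inv_pow {z : ℝ} (hz : 0 < z) (i : Fin 2) :
    FourierExpDecay z (fun x => ((x i ^ 2 * (‖x‖ ^ 2 + z ^ 2)⁻¹ ^ 5 : ℝ) : ℂ)) := by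
  let v : EuclideanSpace ℝ (Fin 2) := EuclideanSpace.single i 1
  have hv : ∀ x : EuclideanSpace ℝ (Fin 2), inner ℝ x v = x i := fun x => by
    simp [v, EuclideanSpace.inner_single_right]
  have hle : ∀ x : EuclideanSpace ℝ (Fin 2), x i ^ 2 ≤ ‖x‖ ^ 2 := fun x => by
    rw [← sq_abs, ← Real.norm_eq_abs]
    gcongr
    exact PiLp.norm_apply_le x i
  have hpos : ∀ x : EuclideanSpace ℝ (Fin 2), 0 < ‖x‖ ^ 2 + z ^ 2 := fun x => by positivity
  have hcont : ∀ n, Continuous fun x : EuclideanSpace ℝ (Fin 2) => (‖x‖ ^ 2 + z ^ 2)⁻¹ ^ n :=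
    fun n => Continuous.pow (Continuous.inv₀ (by fun_prop) fun x => (hpos x).ne') n
  have hI : ∀ n, Integrable fun x : EuclideanSpace ℝ (Fin 2) => (‖x‖ ^ 2 + z ^ 2)⁻¹ ^ (n + 2) :=
    fun n => by simpa only [RCLike.re_eq_complex_re, Complex.ofReal_re] using
      (fourierExpDecay_inv_pow n hz).1.re
  have I1 : Integrable fun x : EuclideanSpace ℝ (Fin 2) =>
      x i * (‖x‖ ^ 2 + z ^ 2)⁻¹ ^ 4 := by
    refine ((hI 1).const_mul (2 * z)⁻¹).mono' (by have := hcont 4; fun_prop) ?_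
    filter_upwards with x
    rw [norm_mul, Real.norm_of_nonneg (r := _ ^ 4) (by have := hpos x; positivity),
      Real.norm_eq_abs, pow_succ _ 3, mul_comm _ (_ ⁻¹), ← mul_assoc]
    have := hpos x
    gcongr
    rw [← div_eq_mul_inv, div_le_iff₀ this, inv_mul_eq_div, le_div_iff₀ (by positivity)]
    nlinarith [hle x, sq_nonneg (|x i| - z), sq_abs (x i)]
  have I2 : Integrable fun x : EuclideanSpace ℝ (Fin 2) =>
      x i ^ 2 * (‖x‖ ^ 2 + z ^ 2)⁻¹ ^ 5 := by
    refine (hI 2).mono' (by have := hcont 5; fun_prop) ?_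
    filter_upwards with x
    have := hpos x
    rw [Real.norm_of_nonneg (by positivity), pow_succ _ 4, mul_comm _ (_ ⁻¹), ← mul_assoc]
    refine mul_le_of_le_one_left (by positivity) ?_
    rw [← div_eq_mul_inv, div_le_one this]
    nlinarith [hle x]
  have D1 : FourierExpDecay z (fun x => ((-6 * (x i * (‖x‖ ^ 2 + z ^ 2)⁻¹ ^ 4) : ℝ) : ℂ)) := by
    refine (fourierExpDecay_inv_pow 1 hz).of_hasLineDerivAt (I1.const_mul _).ofReal v fun x => ?_
    have h := hasLineDerivAt_norm_sq_add_inv_pow 3 hz x v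
    rw [hv] at h
    unfold HasLineDerivAt
    convert! HasDerivAt.ofReal_comp h using 1
    push_cast; ring
  have D2 : FourierExpDecay z (fun x => ((-6 * (‖x‖ ^ 2 + z ^ 2)⁻¹ ^ 4 +
      48 * (x i ^ 2 * (‖x‖ ^ 2 + z ^ 2)⁻¹ ^ 5) : ℝ) : ℂ)) := by
    refine D1.of_hasLineDerivAt (((hI 2).const_mul _).add (I2.const_mul _)).ofReal v fun x => ?_
    have h : HasDerivAt (fun t : ℝ => (‖x + t • v‖ ^ 2 + z ^ 2)⁻¹ ^ 4) _ 0 :=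
      hasLineDerivAt_norm_sq_add_inv_pow 4 hz x v
    have hc : HasDerivAt (fun t : ℝ => (x + t • v) i) 1 0 := by
      simpa [v] using (hasDerivAt_id (0 : ℝ)).const_add (x i)
    rw [hv] at h
    unfold HasLineDerivAt
    convert! HasDerivAt.ofReal_comp ((hc.fun_mul h).const_mul (-6)) using 1
    simp only [zero_smul, add_zero]
    push_cast; ring
  convert! (D2.add ((fourierExpDecay_inv_pow 2 hz).const_mul 6)).const_mul (1 / 48) using 2 with x
  push_cast; ring

/-- **Frequency-decay Lemma (exponential frequency suppression).**
For standoff `z₀ > 0` and constant `μ > 0`, each squared dipolar Green-tensor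
channel `G_a²` is integrable on `ℝ²`, and there are `C ≥ 0` and `m : ℕ` with
`|𝓕 (G_a²) (ξ)| ≤ C (1 + ‖ξ‖)^m e^{−2π z₀ ‖ξ‖}` for all `ξ`. -/
theorem green_channel_squared_fourier_decay
    (z₀ μ : ℝ) (hz : 0 < z₀) (hμ : 0 < μ)
    (R : EuclideanSpace ℝ (Fin 2) → EuclideanSpace ℝ (Fin 3))
    (hR : ∀ x, R x = ![x 0, x 1, z₀])
    (G : Fin 3 → EuclideanSpace ℝ (Fin 2) → ℝ)
    (hG : ∀ a x, G a x =
      (μ / (4 * π)) * (3 * R x a * z₀ - ‖R x‖ ^ 2 * (if a = 2 then 1 else 0)) /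
        ‖R x‖ ^ 5) :
    (∀ a, Integrable fun x => (G a x) ^ 2) ∧
      ∃ C : ℝ, 0 ≤ C ∧ ∃ m : ℕ, ∀ (a : Fin 3) (ξ : EuclideanSpace ℝ (Fin 2)),
        ‖𝓕 (fun x => ((G a x) ^ 2 : ℂ)) ξ‖ ≤
          C * (1 + ‖ξ‖) ^ m * Real.exp (-(2 * π * z₀ * ‖ξ‖)) := by
  have hnorm : ∀ x, ‖R x‖ ^ 2 = ‖x‖ ^ 2 + z₀ ^ 2 := fun x => by
    rw [EuclideanSpace.real_norm_sq_eq, EuclideanSpace.real_norm_sq_eq, Fin.sum_univ_three,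
      Fin.sum_univ_two, hR]
    simp
  have hsq : ∀ a x, G a x ^ 2 = (μ / (4 * π)) ^ 2 *
      ((3 * R x a * z₀ - (‖x‖ ^ 2 + z₀ ^ 2) * (if a = 2 then 1 else 0)) ^ 2 *
        (‖x‖ ^ 2 + z₀ ^ 2)⁻¹ ^ 5) := fun a x => by
    rw [hG, div_pow, ← pow_mul, mul_comm 5 2, pow_mul, hnorm, inv_pow, mul_pow]
    ring
  have hdecay : ∀ a, FourierExpDecay z₀ (fun x => (G a x : ℂ) ^ 2) := fun a => by
    simp only [← Complex.ofReal_pow, hsq]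
    simp only [Complex.ofReal_mul ((μ / (4 * π)) ^ 2)]
    refine FourierExpDecay.const_mul ?_ _
    fin_cases a
    · convert! (fourierExpDecay_coord_sq_mul_inv_pow hz 0).const_mul (9 * z₀ ^ 2) using 2 with x
      simp [hR]; ring
    · convert! (fourierExpDecay_coord_sq_mul_inv_pow hz 1).const_mul (9 * z₀ ^ 2) using 2 with x
      simp [hR]; ring
    · convert! (((fourierExpDecay_inv_pow 3 hz).const_mul (9 * z₀ ^ 4)).add
        ((fourierExpDecay_inv_pow 2 hz).const_mul (-6 * z₀ ^ 2))).add
        (fourierExpDecay_inv_pow 1 hz) using 2 with x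
      have h0 : ‖x‖ ^ 2 + z₀ ^ 2 ≠ 0 := by positivity
      norm_cast
      simp [hR]
      field_simp
      ring
  refine ⟨fun a => ?_, ?_⟩
  · simpa [← Complex.ofReal_pow] using (hdecay a).1.re
  · choose hi C hC m hCm using hdecay
    refine ⟨∑ a, C a, Finset.sum_nonneg fun a _ => hC a, ∑ a, m a, fun a ξ => (hCm a ξ).trans ?_⟩
    have h1 : (1 : ℝ) ≤ 1 + ‖ξ‖ := by linarith [norm_nonneg ξ]
    gcongr
    · exact Finset.sum_nonneg fun a _ => hC a
    · exact Finset.single_le_sum (fun a _ => hC a) (Finset.mem_univ a)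
    · exact Finset.single_le_sum (fun a _ => Nat.zero_le (m a)) (Finset.mem_univ a)
end
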